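/- Let V be a polynomial with real coefficients, E ∈ ℝ, and let ψ : ℝ → ℂ be a Schwartz function satisfying −(1/2)ψ''(x) + V(x)ψ(x) = Eψ(x) for all x ∈ ℝ. Define the Wigner function f(x,p) = (1/(2π)) ∫_ℝ conj(ψ(x + y/2)) ψ(x − y/2) e^{−i p y} dy. Then f satisfies the Wigner eigenvalue problem: for all (x,p) ∈ ℝ², (1/2) · ( −(1/4) ∂²f/∂x²(x,p) + p² f(x,p) + Σ_{m ≥ 0} (2/((2m)! · (−4)^m)) · V^{(2m)}(x) · ∂^{2m}f/∂p^{2m}(x,p) ) = E · f(x,p), where V^{(k)} denotes the k-th derivative of V and the sum has finitely many nonzero terms since V is a polynomial. -/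

import Mathlib

open MeasureTheory

open SchwartzMap

lemma norm_exp_neg_I_mul_mul (p y : ℝ) : ‖Complex.exp (-Complex.I * p * y)‖ = 1 := by
  simp [Complex.norm_exp]

lemma integrable_mul_exp_neg_I_mul_mul (p : ℝ) (G : 𝓢(ℝ, ℂ)) :
    Integrable fun y : ℝ => G y * Complex.exp (-Complex.I * p * y) :=
  G.integrable.mul_bdd (c := 1) (by fun_prop)
    (.of_forall fun y => (norm_exp_neg_I_mul_mul p y).le)

/-- The Fourier integral `∫ G(y) exp(-i p y) dy` of a Schwartz function, as a linear map in `G`. -/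
noncomputable def fourierIntegralAt (p : ℝ) : 𝓢(ℝ, ℂ) →ₗ[ℂ] ℂ where
  toFun G := ∫ y : ℝ, G y * Complex.exp (-Complex.I * p * y)
  map_add' G H := by
    simp only [add_apply, add_mul]
    exact integral_add (integrable_mul_exp_neg_I_mul_mul p G) (integrable_mul_exp_neg_I_mul_mul p H)
  map_smul' c G := by
    simp only [smul_apply, smul_eq_mul, mul_assoc, RingHom.id_apply]
    exact integral_const_mul c _

lemma fourierIntegralAt_apply (p : ℝ) (G : 𝓢(ℝ, ℂ)) :
    fourierIntegralAt p G = ∫ y : ℝ, G y * Complex.exp (-Complex.I * p * y) := rfl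

/-- Multiplication of a Schwartz function by `-i y`. -/
noncomputable def negIMul : 𝓢(ℝ, ℂ) →L[ℂ] 𝓢(ℝ, ℂ) :=
  smulLeftCLM ℂ fun y : ℝ => -Complex.I * (y : ℂ)

lemma negIMul_apply (G : 𝓢(ℝ, ℂ)) (y : ℝ) : negIMul G y = -Complex.I * y * G y := by
  have h : Function.HasTemperateGrowth fun y : ℝ => -Complex.I * (y : ℂ) := by fun_prop
  rw [negIMul, smulLeftCLM_apply_apply h, smul_eq_mul]

lemma iterate_negIMul_apply (n : ℕ) (G : 𝓢(ℝ, ℂ)) (y : ℝ) :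
    (negIMul^[n] G) y = (-Complex.I * y) ^ n * G y := by
  induction n with
  | zero => simp
  | succ n ih => rw [Function.iterate_succ_apply', negIMul_apply, ih]; ring

lemma hasDerivAt_fourierIntegralAt (G : 𝓢(ℝ, ℂ)) (p : ℝ) :
    HasDerivAt (fun q => fourierIntegralAt q G) (fourierIntegralAt p (negIMul G)) p := by
  refine (hasDerivAt_integral_of_dominated_loc_of_deriv_le (μ := volume)
    (F := fun (q y : ℝ) => G y * Complex.exp (-Complex.I * q * y))
    (F' := fun (q y : ℝ) => negIMul G y * Complex.exp (-Complex.I * q * y))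
    (bound := fun y => ‖negIMul G y‖) Filter.univ_mem (.of_forall fun q => ?_) ?_ ?_
    (.of_forall fun y q _ => ?_) (negIMul G).integrable.norm (.of_forall fun y q _ => ?_)).2
  · exact Continuous.aestronglyMeasurable (by fun_prop)
  · exact integrable_mul_exp_neg_I_mul_mul p G
  · exact Continuous.aestronglyMeasurable (by fun_prop)
  · rw [norm_mul, norm_exp_neg_I_mul_mul, mul_one]
  · have h : HasDerivAt (fun q : ℝ => -Complex.I * (q : ℂ) * y) (-Complex.I * 1 * y) q :=
      ((Complex.ofRealCLM.hasDerivAt (x := q)).const_mul (-Complex.I)).mul_const (y : ℂ)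
    refine (h.cexp.const_mul (G y)).congr_deriv ?_
    rw [negIMul_apply]
    ring

lemma iteratedDeriv_fourierIntegralAt (n : ℕ) (G : 𝓢(ℝ, ℂ)) :
    iteratedDeriv n (fun q => fourierIntegralAt q G) =
      fun q => fourierIntegralAt q (negIMul^[n] G) := by
  induction n with
  | zero => simp
  | succ n ih =>
    ext q
    rw [iteratedDeriv_succ, ih, (hasDerivAt_fourierIntegralAt _ q).deriv,
      Function.iterate_succ_apply']

lemma fourierIntegralAt_derivCLM (p : ℝ) (G : 𝓢(ℝ, ℂ)) :
    fourierIntegralAt p (derivCLM ℂ ℂ G) = Complex.I * p * fourierIntegralAt p G := by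
  have integrable_exp := integrable_mul_exp_neg_I_mul_mul p
  have hexp (y : ℝ) : HasDerivAt (fun y : ℝ => Complex.exp (-Complex.I * p * y))
      (-Complex.I * p * Complex.exp (-Complex.I * p * y)) y := by
    have h : HasDerivAt (fun y : ℝ => -Complex.I * p * (y : ℂ)) (-Complex.I * p * 1) y :=
      (Complex.ofRealCLM.hasDerivAt (x := y)).const_mul (-Complex.I * p)
    exact h.cexp.congr_deriv (by ring)
  have key := integral_mul_deriv_eq_deriv_mul_of_integrable
    (u := G) (u' := deriv G) (v := fun y : ℝ => Complex.exp (-Complex.I * p * y))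
    (v' := fun y : ℝ => -Complex.I * p * Complex.exp (-Complex.I * p * y))
    (fun y _ => G.differentiableAt.hasDerivAt) (fun y _ => hexp y)
    (((integrable_exp G).const_mul (-Complex.I * p)).congr (.of_forall fun y => by
      simp only [Pi.mul_apply]; ring))
    (integrable_exp (derivCLM ℂ ℂ G)) (integrable_exp G)
  simp only [fourierIntegralAt_apply, derivCLM_apply]
  rw [← neg_eq_iff_eq_neg.mpr key, ← integral_neg, ← integral_const_mul]
  congr 1 with y
  ring

/-- The Schwartz function `y ↦ A(x + y/2) B(x - y/2)`. -/
noncomputable def wignerProduct (A B : 𝓢(ℝ, ℂ)) (x : ℝ) : 𝓢(ℝ, ℂ) :=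
  pairing (ContinuousLinearMap.mul ℂ ℂ)
    (compCLMOfAntilipschitz (K := 2) (g := fun y : ℝ => x + y / 2) ℂ
      (by simp only [div_eq_mul_inv]; fun_prop)
      (AntilipschitzWith.of_le_mul_dist fun y z => by
        simp only [Real.dist_eq, NNReal.coe_ofNat]
        rw [add_sub_add_left_eq_sub, ← sub_div, abs_div, abs_two,
          mul_div_cancel₀ _ (two_ne_zero (α := ℝ))]) A)
    (compCLMOfAntilipschitz (K := 2) (g := fun y : ℝ => x - y / 2) ℂ
      (by simp only [div_eq_mul_inv]; fun_prop)
      (AntilipschitzWith.of_le_mul_dist fun y z => by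
        simp only [Real.dist_eq, NNReal.coe_ofNat]
        rw [sub_sub_sub_cancel_left, ← sub_div, abs_div, abs_two,
          mul_div_cancel₀ _ (two_ne_zero (α := ℝ)),
          abs_sub_comm]) B)

lemma wignerProduct_apply (A B : 𝓢(ℝ, ℂ)) (x y : ℝ) :
    wignerProduct A B x y = A (x + y / 2) * B (x - y / 2) := rfl

lemma derivCLM_wignerProduct (A B : 𝓢(ℝ, ℂ)) (x : ℝ) :
    derivCLM ℂ ℂ (wignerProduct A B x) =
      (1 / 2 : ℂ) • (wignerProduct (derivCLM ℂ ℂ A) B x - wignerProduct A (derivCLM ℂ ℂ B) x) := by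
  ext y
  have hA : HasDerivAt (fun y : ℝ => A (x + y / 2)) ((1 / 2 : ℝ) • deriv A (x + y / 2)) y :=
    A.differentiableAt.hasDerivAt.scomp y (((hasDerivAt_id y).div_const 2).const_add x)
  have hB : HasDerivAt (fun y : ℝ => B (x - y / 2)) ((-(1 / 2) : ℝ) • deriv B (x - y / 2)) y :=
    B.differentiableAt.hasDerivAt.scomp y (((hasDerivAt_id y).div_const 2).const_sub x)
  have h : deriv (wignerProduct A B x) y = _ := (hA.mul hB).deriv
  simp only [derivCLM_apply, h, smul_apply, sub_apply, wignerProduct_apply, Complex.real_smul,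
    smul_eq_mul]
  push_cast
  ring

lemma exists_norm_wignerProduct_le (A B : 𝓢(ℝ, ℂ)) :
    ∃ C : ℝ, ∀ x y : ℝ, ‖wignerProduct A B x y‖ ≤ C * (1 + ‖y‖) ^ (-2 : ℝ) := by
  have hdecay (D : 𝓢(ℝ, ℂ)) : ∃ C : ℝ, 0 ≤ C ∧ ∀ u : ℝ, (1 + ‖u‖) ^ 2 * ‖D u‖ ≤ C := by
    have h u := one_add_le_sup_seminorm_apply (𝕜 := ℝ) (m := (2, 0)) le_rfl le_rfl D u
    simp only [norm_iteratedFDeriv_zero] at h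
    exact ⟨_, (by positivity : (0 : ℝ) ≤ (1 + ‖(0 : ℝ)‖) ^ 2 * ‖D 0‖).trans (h 0), h⟩
  obtain ⟨C, hC0, hC⟩ := hdecay A
  obtain ⟨D, -, hD⟩ := hdecay B
  refine ⟨C * D, fun x y => ?_⟩
  rw [Real.rpow_neg (by positivity), ← div_eq_mul_inv, le_div_iff₀ (by positivity),
    wignerProduct_apply, norm_mul]
  norm_cast
  have hy : ‖y‖ ≤ ‖x + y / 2‖ + ‖x - y / 2‖ := by
    refine le_of_eq_of_le ?_ (norm_sub_le _ _)
    congr 1; ring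
  have hle : 1 + ‖y‖ ≤ (1 + ‖x + y / 2‖) * (1 + ‖x - y / 2‖) := by
    nlinarith [norm_nonneg (x + y / 2), norm_nonneg (x - y / 2),
      mul_nonneg (norm_nonneg (x + y / 2)) (norm_nonneg (x - y / 2))]
  calc ‖A (x + y / 2)‖ * ‖B (x - y / 2)‖ * (1 + ‖y‖) ^ 2
      ≤ ‖A (x + y / 2)‖ * ‖B (x - y / 2)‖ *
          ((1 + ‖x + y / 2‖) * (1 + ‖x - y / 2‖)) ^ 2 := by gcongr
    _ = ((1 + ‖x + y / 2‖) ^ 2 * ‖A (x + y / 2)‖) *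
          ((1 + ‖x - y / 2‖) ^ 2 * ‖B (x - y / 2)‖) := by ring
    _ ≤ C * D := by
        gcongr
        exacts [hC _, hD _]

lemma hasDerivAt_fourierIntegralAt_wignerProduct (A B : 𝓢(ℝ, ℂ)) (x p : ℝ) :
    HasDerivAt (fun x' => fourierIntegralAt p (wignerProduct A B x'))
      (fourierIntegralAt p (wignerProduct (derivCLM ℂ ℂ A) B x) +
        fourierIntegralAt p (wignerProduct A (derivCLM ℂ ℂ B) x)) x := by
  obtain ⟨C, hC⟩ := exists_norm_wignerProduct_le (derivCLM ℂ ℂ A) B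
  obtain ⟨D, hD⟩ := exists_norm_wignerProduct_le A (derivCLM ℂ ℂ B)
  rw [← map_add]
  refine (hasDerivAt_integral_of_dominated_loc_of_deriv_le (μ := volume)
    (F := fun (x' y : ℝ) => wignerProduct A B x' y * Complex.exp (-Complex.I * p * y))
    (F' := fun (x' y : ℝ) => (wignerProduct (derivCLM ℂ ℂ A) B x' +
      wignerProduct A (derivCLM ℂ ℂ B) x') y * Complex.exp (-Complex.I * p * y))
    (bound := fun y => (C + D) * (1 + ‖y‖) ^ (-2 : ℝ)) Filter.univ_mem
    (.of_forall fun x' => ?_) ?_ ?_ (.of_forall fun y x' _ => ?_)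
    ((integrable_one_add_norm (by simp)).const_mul _) (.of_forall fun y x' _ => ?_)).2
  · exact Continuous.aestronglyMeasurable (by fun_prop)
  · exact integrable_mul_exp_neg_I_mul_mul p (wignerProduct A B x)
  · exact Continuous.aestronglyMeasurable (by fun_prop)
  · rw [norm_mul, norm_exp_neg_I_mul_mul, mul_one, add_apply, add_mul]
    exact (norm_add_le _ _).trans (add_le_add (hC x' y) (hD x' y))
  · have hA : HasDerivAt (fun x : ℝ => A (x + y / 2)) (deriv A (x' + y / 2)) x' :=
      A.differentiableAt.hasDerivAt.comp_add_const x' (y / 2)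
    have hB : HasDerivAt (fun x : ℝ => B (x - y / 2)) (deriv B (x' - y / 2)) x' :=
      B.differentiableAt.hasDerivAt.comp_sub_const x' (y / 2)
    exact (hA.mul hB).mul_const _

lemma Polynomial.eval_add_eq_sum_range {K : Type*} [Field K] [CharZero K] (V : Polynomial K)
    {N : ℕ} (hN : V.natDegree < N) (x h : K) :
    V.eval (x + h) =
      ∑ n ∈ Finset.range N, (Polynomial.derivative^[n] V).eval x / (n.factorial : K) * h ^ n := by
  rw [add_comm, ← Polynomial.taylor_eval, Polynomial.eval_eq_sum_range' (n := N)
    (by rwa [Polynomial.natDegree_taylor])]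
  refine Finset.sum_congr rfl fun n _ => ?_
  rw [Polynomial.taylor_coeff, ← Polynomial.factorial_smul_hasseDeriv]
  have : (n.factorial : K) ≠ 0 := by exact_mod_cast n.factorial_ne_zero
  rw [LinearMap.smul_apply, Polynomial.eval_smul, nsmul_eq_mul, mul_div_cancel_left₀ _ this]

/-- Even part of the Taylor expansion of a polynomial. -/
lemma Polynomial.eval_add_add_eval_sub {K : Type*} [Field K] [CharZero K] (V : Polynomial K)
    (x h : K) :
    V.eval (x + h) + V.eval (x - h) =
      ∑ m ∈ Finset.range (V.natDegree + 1),
        2 / ((2 * m).factorial : K) * (Polynomial.derivative^[2 * m] V).eval x * h ^ (2 * m) := by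
  have hN : V.natDegree < 2 * (V.natDegree + 1) := by omega
  rw [sub_eq_add_neg, V.eval_add_eq_sum_range hN, V.eval_add_eq_sum_range hN,
    ← Finset.sum_add_distrib]
  generalize V.natDegree + 1 = N
  induction N with
  | zero => simp
  | succ N ih =>
    rw [Finset.sum_range_succ _ N, ← ih, mul_add, mul_one, Finset.sum_range_succ,
      Finset.sum_range_succ, (even_two_mul N).neg_pow, (odd_two_mul_add_one N).neg_pow]
    ring

/-- The Wigner transform of a Schrödinger eigenfunction with energy `E` (polynomial
potential `V`) is an eigenfunction of the Wigner energy operator with eigenvalue `E`,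
the convolution term being written in its local Taylor-expanded form. -/
theorem wigner_of_eigenfunction_satisfies_wigner_eigenvalue_problem
    (V : Polynomial ℝ) (E : ℝ) (ψ : SchwartzMap ℝ ℂ)
    (hψ : ∀ x : ℝ,
      -(1/2 : ℂ) * deriv (deriv (ψ : ℝ → ℂ)) x + ((V.eval x : ℝ) : ℂ) * ψ x = (E : ℂ) * ψ x)
    (f : ℝ → ℝ → ℂ)
    (hf : ∀ x p : ℝ, f x p = (1 / (2 * Real.pi) : ℂ) *
      ∫ y : ℝ, (starRingEnd ℂ) (ψ (x + y / 2)) * ψ (x - y / 2) *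
        Complex.exp (-Complex.I * p * y)) :
    ∀ x p : ℝ,
      (1/2 : ℂ) * (-(1/4 : ℂ) * deriv (deriv (fun x' : ℝ => f x' p)) x
        + (p : ℂ) ^ 2 * f x p
        + ∑ m ∈ Finset.range (V.natDegree + 1),
            (2 / ((((2 * m).factorial : ℕ) : ℂ) * (-4 : ℂ) ^ m)) *
              (((Polynomial.derivative^[2 * m] V).eval x : ℝ) : ℂ) *
              iteratedDeriv (2 * m) (fun q : ℝ => f x q) p)
      = (E : ℂ) * f x p := by
  intro x p
  let A : 𝓢(ℝ, ℂ) := (postcompCLM (𝕜 := ℝ) (Complex.conjCLE : ℂ →L[ℝ] ℂ)) ψ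
  have hAψ (u : ℝ) : A u = (starRingEnd ℂ) (ψ u) := rfl
  have hAd : (deriv A : ℝ → ℂ) = fun u => (starRingEnd ℂ) (deriv ψ u) := by
    ext u
    exact (ψ.differentiableAt (x := u)).hasDerivAt.star.deriv
  have hAdd (u : ℝ) : deriv (deriv A) u = (starRingEnd ℂ) (deriv (deriv ψ) u) := by
    rw [hAd]
    exact ((derivCLM ℂ ℂ ψ).differentiableAt (x := u)).hasDerivAt.star.deriv
  have hψ2 (u : ℝ) : deriv (deriv ψ) u = 2 * (V.eval u - E) * ψ u := by
    linear_combination -2 * hψ u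
  have hA2 (u : ℝ) : deriv (deriv A) u = 2 * (V.eval u - E) * A u := by
    rw [hAdd, hψ2, hAψ]
    simp only [map_mul, map_sub, Complex.conj_ofReal, Complex.conj_ofNat]
  have hfW (x p : ℝ) :
      f x p = (1 / (2 * Real.pi) : ℂ) * fourierIntegralAt p (wignerProduct A ψ x) := hf x p
  set D : 𝓢(ℝ, ℂ) →L[ℂ] 𝓢(ℝ, ℂ) := derivCLM ℂ ℂ with hD
  have hfx : deriv (deriv fun x' : ℝ => f x' p) x = (1 / (2 * Real.pi) : ℂ) *
      fourierIntegralAt p (wignerProduct (D (D A)) ψ x + wignerProduct (D A) (D ψ) x +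
        (wignerProduct (D A) (D ψ) x + wignerProduct A (D (D ψ)) x)) := by
    have h1 : (deriv fun x' : ℝ => f x' p) = fun x' => (1 / (2 * Real.pi) : ℂ) *
        (fourierIntegralAt p (wignerProduct (D A) ψ x') +
          fourierIntegralAt p (wignerProduct A (D ψ) x')) := by
      ext x'
      simp only [hfW]
      exact ((hasDerivAt_fourierIntegralAt_wignerProduct A ψ x' p).const_mul _).deriv
    rw [h1]
    simp only [map_add]
    exact (((hasDerivAt_fourierIntegralAt_wignerProduct (D A) ψ x p).add
      (hasDerivAt_fourierIntegralAt_wignerProduct A (D ψ) x p)).const_mul _).deriv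
  have hfp (n : ℕ) : iteratedDeriv n (fun q : ℝ => f x q) p = (1 / (2 * Real.pi) : ℂ) *
      fourierIntegralAt p (negIMul^[n] (wignerProduct A ψ x)) := by
    simp only [hfW]
    rw [iteratedDeriv_const_mul_field, iteratedDeriv_fourierIntegralAt]
  have hp2 : (p : ℂ) ^ 2 * fourierIntegralAt p (wignerProduct A ψ x) =
      -fourierIntegralAt p (D (D (wignerProduct A ψ x))) := by
    rw [hD, fourierIntegralAt_derivCLM, fourierIntegralAt_derivCLM]
    linear_combination ((p : ℂ) ^ 2 * fourierIntegralAt p (wignerProduct A ψ x)) * Complex.I_sq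
  set P := wignerProduct A ψ x with hP
  let c (m : ℕ) : ℂ := (2 / ((((2 * m).factorial : ℕ) : ℂ) * (-4 : ℂ) ^ m)) *
    (((Polynomial.derivative^[2 * m] V).eval x : ℝ) : ℂ)
  have hDD : D (D P) = (1 / 4 : ℂ) • (wignerProduct (D (D A)) ψ x -
      wignerProduct (D A) (D ψ) x - (wignerProduct (D A) (D ψ) x - wignerProduct A (D (D ψ)) x)) := by
    rw [hD, hP, derivCLM_wignerProduct, map_smul, map_sub, derivCLM_wignerProduct,
      derivCLM_wignerProduct, ← smul_sub, smul_smul]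
    norm_num
  have hsum (y : ℝ) : ∑ m ∈ Finset.range (V.natDegree + 1), c m * (-Complex.I * y) ^ (2 * m) =
      V.eval (x + y / 2) + V.eval (x - y / 2) := by
    have h := congrArg (Complex.ofReal) (V.eval_add_add_eval_sub x (y / 2))
    push_cast at h
    rw [h]
    refine Finset.sum_congr rfl fun m _ => ?_
    have h4 : (-Complex.I * y) ^ (2 * m) = (-4 : ℂ) ^ m * (y / 2 : ℂ) ^ (2 * m) := by
      rw [pow_mul, pow_mul, ← mul_pow]
      congr 1
      linear_combination (y : ℂ) ^ 2 * Complex.I_sq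
    have h0 : (-4 : ℂ) ^ m ≠ 0 := by simp
    have h1 : (((2 * m).factorial : ℕ) : ℂ) ≠ 0 := by exact_mod_cast (2 * m).factorial_ne_zero
    simp only [c, h4]
    field_simp
  have hS : -(1 / 4 : ℂ) • (wignerProduct (D (D A)) ψ x + wignerProduct (D A) (D ψ) x +
        (wignerProduct (D A) (D ψ) x + wignerProduct A (D (D ψ)) x)) - D (D P) +
      ∑ m ∈ Finset.range (V.natDegree + 1), c m • negIMul^[2 * m] P = (2 * E : ℂ) • P := by
    rw [hDD]
    ext y
    have hs : (∑ m ∈ Finset.range (V.natDegree + 1), c m • negIMul^[2 * m] P) y =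
        (V.eval (x + y / 2) + V.eval (x - y / 2)) * P y := by
      rw [sum_apply, ← hsum, Finset.sum_mul]
      refine Finset.sum_congr rfl fun m _ => ?_
      rw [smul_apply, iterate_negIMul_apply, smul_eq_mul, ← mul_assoc]
    simp only [add_apply, sub_apply, smul_apply, hs, smul_eq_mul]
    simp only [hP, wignerProduct_apply]
    have h1 : D (D A) (x + y / 2) = _ := hA2 (x + y / 2)
    have h2 : D (D ψ) (x - y / 2) = _ := hψ2 (x - y / 2)
    rw [h1, h2]
    ring
  have hW := congrArg (fourierIntegralAt p) hS
  rw [map_add, map_sub, map_smul, map_smul, map_sum] at hW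
  simp only [map_smul, smul_eq_mul] at hW
  rw [hfx, hfW]
  simp only [hfp]
  have hfactor : ∑ m ∈ Finset.range (V.natDegree + 1), c m * ((1 / (2 * Real.pi) : ℂ) *
      fourierIntegralAt p (negIMul^[2 * m] P)) = (1 / (2 * Real.pi) : ℂ) *
      ∑ m ∈ Finset.range (V.natDegree + 1), c m * fourierIntegralAt p (negIMul^[2 * m] P) := by
    rw [Finset.mul_sum]
    exact Finset.sum_congr rfl fun m _ => by ring
  rw [hfactor]
  linear_combination (1 / 2 : ℂ) * (1 / (2 * Real.pi) : ℂ) * (hW + hp2)
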